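/- arXiv:1307.0469 — 4 statements merged into one kernel-verified Lean document; each statement's English description precedes it below -/
import Mathlib

section
/- The set Q is a subgroup of A. Concretely: 1 ∈ Q; if α, α' ∈ Q then α·α' ∈ Q; and if α ∈ Q then α⁻¹ ∈ Q. -/
/-- An element `χ` of `A` is *admissible* if it is not fixed by any nontrivial
element of `W`. -/
def AdmissibleElt (W : Type*) {A : Type*} [Group W] [CommGroup A]
    [MulDistribMulAction W A] (χ : A) : Prop :=
  ∀ w : W, w • χ = χ → w = 1

/-- The set `Q` of `α ∈ A` such that for every admissible `χ ∈ A` there is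
`w ∈ W` with `α = χ · (w • χ)⁻¹`. -/
def QSet (W A : Type*) [Group W] [CommGroup A] [MulDistribMulAction W A] : Set A :=
  {α | ∀ χ : A, AdmissibleElt W χ → ∃ w : W, α = χ * (w • χ)⁻¹}

/-- The orbit of an admissible element consists of admissible elements. -/
theorem AdmissibleElt.smul {W A : Type*} [Group W] [CommGroup A] [MulDistribMulAction W A]
    {χ : A} (hχ : AdmissibleElt W χ) (w : W) : AdmissibleElt W (w • χ) := by
  intro v hv
  have h : w⁻¹ * v * w = 1 := hχ _ (by rw [mul_smul, mul_smul, hv, inv_smul_smul])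
  simpa using (conj_eq_one_iff (a := w⁻¹) (b := v)).mp (by simpa using h)

theorem one_mem_QSet (W A : Type*) [Group W] [CommGroup A] [MulDistribMulAction W A] :
    (1 : A) ∈ QSet W A :=
  fun χ _ => ⟨1, by simp⟩

theorem mul_mem_QSet {W A : Type*} [Group W] [CommGroup A] [MulDistribMulAction W A]
    {α β : A} (hα : α ∈ QSet W A) (hβ : β ∈ QSet W A) : α * β ∈ QSet W A := by
  intro χ hχ
  obtain ⟨w, rfl⟩ := hα χ hχ
  obtain ⟨v, rfl⟩ := hβ (w • χ) (hχ.smul w)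
  exact ⟨v * w, by rw [mul_smul]; group⟩

theorem pow_mem_QSet {W A : Type*} [Group W] [CommGroup A] [MulDistribMulAction W A]
    {α : A} (hα : α ∈ QSet W A) (n : ℕ) : α ^ n ∈ QSet W A := by
  induction n with
  | zero => simpa using one_mem_QSet W A
  | succ n ih => rw [pow_succ]; exact mul_mem_QSet ih hα

/-- `Q` is a subgroup of `A`: it contains `1`, and is closed under
multiplication and inversion. -/
theorem QSet_is_subgroup (W A : Type*) [Group W] [Finite W] [CommGroup A] [Finite A]
    [MulDistribMulAction W A] :
    (1 : A) ∈ QSet W A ∧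
    (∀ α α' : A, α ∈ QSet W A → α' ∈ QSet W A → α * α' ∈ QSet W A) ∧
    (∀ α : A, α ∈ QSet W A → α⁻¹ ∈ QSet W A) := by
  refine ⟨one_mem_QSet W A, fun α α' => mul_mem_QSet, fun α hα => ?_⟩
  have h : α⁻¹ ∈ Submonoid.powers α :=
    (isOfFinOrder_of_finite α).mem_powers_iff_mem_zpowers.mpr
      (inv_mem (Subgroup.mem_zpowers α))
  obtain ⟨n, hn⟩ := h
  exact hn ▸ pow_mem_QSet hα n
end

section
/- If the number of admissible elements of A is strictly greater than (#W − 1) times the number of inadmissible elements of A, then Q = {1}. -/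
/-- If `χ` and `ψ` have the same image under `χ ↦ χ * (w • χ)⁻¹` for some `w ≠ 1`, then
`χ * ψ⁻¹` is inadmissible. -/
theorem not_admissibleElt_mul_inv {W A : Type*} [Group W] [CommGroup A]
    [MulDistribMulAction W A] {w : W} (hw : w ≠ 1) {χ ψ : A}
    (h : χ * (w • χ)⁻¹ = ψ * (w • ψ)⁻¹) : ¬ AdmissibleElt W (χ * ψ⁻¹) := by
  refine fun hadm => hw (hadm w ?_)
  rw [mul_inv_eq_iff_eq_mul, mul_right_comm, eq_mul_inv_iff_mul_eq] at h
  rw [smul_mul', smul_inv', mul_inv_eq_iff_eq_mul, mul_right_comm, eq_mul_inv_iff_mul_eq,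
    mul_comm (w • χ), h]

/-- A nontrivial element of `QSet W A` bounds the number of admissible elements. -/
theorem card_admissibleElt_le_of_mem_QSet {W A : Type*} [Group W] [Finite W]
    [CommGroup A] [Finite A] [MulDistribMulAction W A] {α : A} (hα : α ∈ QSet W A)
    (hα1 : α ≠ 1) :
    Nat.card {χ : A // AdmissibleElt W χ} ≤
      (Nat.card W - 1) * Nat.card {χ : A // ¬ AdmissibleElt W χ} := by
  classical
  rcases isEmpty_or_nonempty {χ : A // AdmissibleElt W χ} with _ | _
  · simp
  have hex (χ : {χ : A // AdmissibleElt W χ}) :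
      ∃ w : {w : W // w ≠ 1}, α = χ.1 * (w.1 • χ.1)⁻¹ := by
    obtain ⟨w, hw⟩ := hα χ.1 χ.2
    exact ⟨⟨w, by rintro rfl; simp [hα1] at hw⟩, hw⟩
  choose f hf using hex
  let r := Function.invFun f
  have hr (χ) : f (r (f χ)) = f χ := Function.invFun_eq ⟨χ, rfl⟩
  have hinadm (χ) : ¬ AdmissibleElt W (χ.1 * (r (f χ)).1⁻¹) := by
    refine not_admissibleElt_mul_inv (f χ).2 ?_
    have hrep := hf (r (f χ))
    rw [hr] at hrep
    exact (hf χ).symm.trans hrep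
  let F : {χ : A // AdmissibleElt W χ} → {w : W // w ≠ 1} × {χ : A // ¬ AdmissibleElt W χ} :=
    fun χ => (f χ, ⟨_, hinadm χ⟩)
  have hF : Function.Injective F := by
    intro χ ψ h
    obtain ⟨h₁, h₂⟩ := Prod.ext_iff.mp h
    have h₁ : f χ = f ψ := h₁
    have h₂ : χ.1 * (r (f χ)).1⁻¹ = ψ.1 * (r (f ψ)).1⁻¹ := congrArg Subtype.val h₂
    rw [h₁] at h₂
    exact Subtype.ext (mul_right_cancel h₂)
  have hcard : Nat.card {w : W // w ≠ 1} = Nat.card W - 1 := by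
    have := Fintype.ofFinite W
    simp [Nat.card_eq_fintype_card, Fintype.card_subtype_compl]
  rw [← hcard, ← Nat.card_prod]
  exact Nat.card_le_card_of_injective F hF

/-- If the number of admissible elements of `A` is strictly greater than
`(#W − 1)` times the number of inadmissible elements, then `Q = {1}`. -/
theorem QSet_eq_one_of_many_admissible (W A : Type*) [Group W] [Finite W]
    [CommGroup A] [Finite A] [MulDistribMulAction W A]
    (h : Nat.card {χ : A // AdmissibleElt W χ} >
      (Nat.card W - 1) * Nat.card {χ : A // ¬ AdmissibleElt W χ}) :
    QSet W A = {1} := by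
  refine Set.eq_singleton_iff_unique_mem.mpr ⟨fun χ _ => ⟨1, by simp⟩, fun α hα => ?_⟩
  by_contra hα1
  exact h.not_ge (card_admissibleElt_le_of_mem_QSet hα hα1)
end

section
/- If α ∈ Q has order d and χ ∈ A is admissible of order m, then d divides m. -/
/-- If `α ∈ Q` has order `d` and `χ ∈ A` is admissible of order `m`,
then `d` divides `m`. -/
theorem QSet_order_dvd (W A : Type*) [Group W] [Finite W] [CommGroup A] [Finite A]
    [MulDistribMulAction W A] (α χ : A) (hα : α ∈ QSet W A)
    (hχ : AdmissibleElt W χ) (d m : ℕ) (hd : orderOf α = d) (hm : orderOf χ = m) :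
    d ∣ m := by
  subst hd hm
  obtain ⟨w, rfl⟩ := hα χ hχ
  apply orderOf_dvd_of_pow_eq_one
  rw [mul_pow, inv_pow, ← smul_pow', pow_orderOf_eq_one, smul_one, inv_one, mul_one]
end

section
/- The n-th power of the matrix w̃ = σ₁ σ₂ ⋯ σ_{n−1} is the scalar matrix (−1)^{n−1} times the identity: w̃ⁿ = (−1)^{n−1} · Iₙ. -/
open Matrix

/-- For `0 ≤ i ≤ n-2` (0-indexed version of `1 ≤ i ≤ n-1`), the `n × n` complex
matrix agreeing with the identity except that its `2 × 2` block in rows and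
columns `i, i+1` is `[[0, 1], [-1, 0]]`. -/
noncomputable def sigmaMat (n i : ℕ) : Matrix (Fin n) (Fin n) ℂ :=
  Matrix.of fun j k =>
    if (j : ℕ) = i ∧ (k : ℕ) = i + 1 then 1
    else if (j : ℕ) = i + 1 ∧ (k : ℕ) = i then -1
    else if j = k ∧ (j : ℕ) ≠ i ∧ (j : ℕ) ≠ i + 1 then 1
    else 0

/-- The canonical Tits-group lift `w̃ = σ₁ σ₂ ⋯ σ_{n-1}` of the standard Coxeter
element of the Weyl group of `GL_n`. -/
noncomputable def titsCoxeterLift (n : ℕ) : Matrix (Fin n) (Fin n) ℂ :=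
  ((List.range (n - 1)).map (sigmaMat n)).prod

theorem sigmaMat_mulVec {n i : ℕ} (hi : i + 1 < n) (f : ℕ → ℂ) :
    sigmaMat n i *ᵥ (fun j : Fin n => f j) =
      fun j : Fin n => if (j : ℕ) = i then f (i + 1)
        else if (j : ℕ) = i + 1 then -f i else f j := by
  ext j
  simp only [mulVec, dotProduct, sigmaMat, of_apply]
  split_ifs with h₁ h₂
  · rw [Finset.sum_eq_single ⟨i + 1, hi⟩]
    · simp [h₁]
    · intro k _ hk
      have : (k : ℕ) ≠ i + 1 := fun h => hk (Fin.ext h)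
      simp [h₁, this]
    · simp
  · rw [Finset.sum_eq_single ⟨i, by omega⟩]
    · simp [h₂]
    · intro k _ hk
      have : (k : ℕ) ≠ i := fun h => hk (Fin.ext h)
      simp [h₂, this]
    · simp
  · rw [Finset.sum_eq_single j]
    · simp [h₁, h₂]
    · intro k _ hk
      simp [h₁, h₂, hk.symm]
    · simp

theorem prod_sigmaMat_mulVec {n m : ℕ} (hm : m < n) (f : ℕ → ℂ) :
    ((List.range m).map (sigmaMat n)).prod *ᵥ (fun j : Fin n => f j) =
      fun j : Fin n => if (j : ℕ) = 0 then f m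
        else if (j : ℕ) ≤ m then -f (j - 1) else f j := by
  induction m generalizing f with
  | zero =>
    ext j
    simp only [List.range_zero, List.map_nil, List.prod_nil, one_mulVec]
    grind
  | succ m ih =>
    rw [List.range_succ, List.map_append, List.prod_append, ← mulVec_mulVec]
    simp only [List.map_cons, List.map_nil, List.prod_singleton]
    rw [sigmaMat_mulVec hm, ih (by omega) fun j =>
      if j = m then f (m + 1) else if j = m + 1 then -f m else f j]
    ext j
    grind

theorem titsCoxeterLift_pow_mulVec {n k : ℕ} (hk : k ≤ n) (f : ℕ → ℂ) :
    titsCoxeterLift n ^ k *ᵥ (fun j : Fin n => f j) =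
      fun j : Fin n => if k ≤ (j : ℕ) then (-1) ^ k * f (j - k)
        else (-1) ^ (k - 1) * f (j + n - k) := by
  induction k with
  | zero => simp
  | succ k ih =>
    rw [pow_succ', ← mulVec_mulVec, ih (by omega), titsCoxeterLift,
      prod_sigmaMat_mulVec (by omega) fun j =>
        if k ≤ j then (-1) ^ k * f (j - k) else (-1) ^ (k - 1) * f (j + n - k)]
    ext j
    have hj := j.isLt
    rcases Nat.eq_zero_or_pos (j : ℕ) with h₀ | h₀
    · have hkn : k ≤ n - 1 := by omega
      have e : n - 1 - k = n - (k + 1) := by omega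
      simp [h₀, hkn, e]
    · have hjn : (j : ℕ) ≤ n - 1 := by omega
      by_cases h : k + 1 ≤ (j : ℕ)
      · have h' : k ≤ (j : ℕ) - 1 := by omega
        have e : (j : ℕ) - 1 - k = j - (k + 1) := by omega
        simp only [h₀.ne', hjn, h, h', e, if_true, if_false]
        ring
      · have h' : ¬ k ≤ (j : ℕ) - 1 := by omega
        have e : (j : ℕ) - 1 + n - k = j + n - (k + 1) := by omega
        obtain ⟨l, rfl⟩ : ∃ l, k = l + 1 := ⟨k - 1, by omega⟩
        simp only [h₀.ne', hjn, h, h', e, if_true, if_false, Nat.add_sub_cancel]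
        ring

/-- The `n`-th power of `w̃ = σ₁ σ₂ ⋯ σ_{n-1}` is the scalar matrix
`(−1)^{n−1} · Iₙ`. -/
theorem titsCoxeterLift_pow_n (n : ℕ) (hn : 1 ≤ n) :
    titsCoxeterLift n ^ n = ((-1 : ℂ) ^ (n - 1)) • (1 : Matrix (Fin n) (Fin n) ℂ) := by
  refine ext_of_mulVec_single fun i => ?_
  have hf : (Pi.single i 1 : Fin n → ℂ) =
      fun j : Fin n => (Pi.single (i : ℕ) 1 : ℕ → ℂ) j := by
    ext j
    simp [Pi.single_apply, Fin.ext_iff]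
  rw [hf, titsCoxeterLift_pow_mulVec le_rfl, smul_mulVec, one_mulVec]
  ext j
  simp [j.isLt.not_ge]
end
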